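/- Let X and Y be real Banach spaces, let T : (0,∞) → L(Y,X) be a family of bounded linear operators such that for every y ∈ Y the map τ ↦ T(τ)y is continuous on (0,∞) and ‖T(τ)‖ ≤ k(1 + τ^{−a})e^{−λτ} for all τ > 0 (with constants k > 0, λ > 0, a ∈ (0,1)), and let B : X × X → Y be a continuous bilinear map with ‖B(x,x')‖_Y ≤ c‖x‖_X‖x'‖_X. Set K̃ = k(1/λ + Γ(1−a)λ^{a−1}) and fix f ∈ C_b(ℝ,Y). For ω ∈ C_b(ℝ,X) define Φ(ω)(t) = ∫_{−∞}^t T(t−s)(B(ω(s),ω(s)) + f(s)) ds. Then for any ρ > 0 and any ω₁, ω₂ ∈ C_b(ℝ,X) with ‖ω₁‖_∞ ≤ ρ and ‖ω₂‖_∞ ≤ ρ, one has sup_{t∈ℝ} ‖Φ(ω₁)(t) − Φ(ω₂)(t)‖_X ≤ 2K̃ c ρ ‖ω₁ − ω₂‖_∞. -/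

import Mathlib

open MeasureTheory Set Filter

noncomputable section

lemma aux_kernel (k lam a : ℝ) (hlam : 0 < lam) (ha : a ∈ Ioo (0:ℝ) 1) :
    IntegrableOn (fun τ : ℝ => k * (1 + τ ^ (-a)) * Real.exp (-lam * τ)) (Ioi 0) ∧
    ∫ τ in Ioi (0:ℝ), k * (1 + τ ^ (-a)) * Real.exp (-lam * τ) =
      k * (1 / lam + Real.Gamma (1 - a) * lam ^ (a - 1)) := by
  have h1 : IntegrableOn (fun τ : ℝ => Real.exp (-lam * τ)) (Ioi 0) :=
    exp_neg_integrableOn_Ioi 0 hlam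
  have h2 : IntegrableOn (fun τ : ℝ => τ ^ (-a) * Real.exp (-lam * τ)) (Ioi 0) := by
    have := integrableOn_rpow_mul_exp_neg_mul_rpow (p := 1) (s := -a) (b := lam)
      (by linarith [ha.2]) one_pos hlam
    simpa using this
  have e : (fun τ : ℝ => k * (1 + τ ^ (-a)) * Real.exp (-lam * τ)) =
      fun τ : ℝ => k * (Real.exp (-lam * τ) + τ ^ (-a) * Real.exp (-lam * τ)) := by
    funext τ; ring
  rw [e]
  refine ⟨(h1.add h2).const_mul k, ?_⟩
  rw [integral_const_mul, integral_add h1 h2]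
  have i1 : ∫ τ in Ioi (0:ℝ), Real.exp (-lam * τ) = 1 / lam := by
    rw [integral_exp_mul_Ioi (by linarith)]
    simp
  have i2 : ∫ τ in Ioi (0:ℝ), τ ^ (-a) * Real.exp (-lam * τ) =
      Real.Gamma (1 - a) * lam ^ (a - 1) := by
    have := Real.integral_rpow_mul_exp_neg_mul_Ioi (a := 1 - a) (r := lam)
      (by linarith [ha.2]) hlam
    have e2 : (1 / lam) ^ (1 - a) = lam ^ (a - 1) := by
      rw [one_div, Real.inv_rpow hlam.le, ← Real.rpow_neg hlam.le]
      congr 1; ring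
    rw [e2, mul_comm] at this
    rw [← this]
    congr 1
    funext τ
    congr 2 <;> ring
  rw [i1, i2]

lemma aux_reflect (F : ℝ → ℝ) (t : ℝ) (hF : IntegrableOn F (Ioi 0)) :
    IntegrableOn (fun s => F (t - s)) (Iio t) ∧
    ∫ s in Iio t, F (t - s) = ∫ τ in Ioi (0:ℝ), F τ := by
  have hm := Measure.measurePreserving_sub_left (volume : Measure ℝ) t
  have he : MeasurableEmbedding (fun s : ℝ => t - s) :=
    (MeasurableEquiv.subLeft t).measurableEmbedding
  have hp : (fun s : ℝ => t - s) ⁻¹' (Ioi 0) = Iio t := by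
    ext s; simp
  constructor
  · have := (hm.integrableOn_comp_preimage he (f := F) (s := Ioi 0)).2 hF
    rw [hp] at this
    exact this
  · have := hm.setIntegral_preimage_emb he F (Ioi 0)
    rwa [hp] at this

lemma aux_cont {X Y : Type*} [NormedAddCommGroup X] [NormedSpace ℝ X]
    [NormedAddCommGroup Y] [NormedSpace ℝ Y]
    (T : ℝ → Y →L[ℝ] X)
    (hTcont : ∀ y : Y, ContinuousOn (fun τ : ℝ => T τ y) (Ioi 0))
    (G : ℝ → ℝ) (hG : ContinuousOn G (Ioi 0))
    (hT : ∀ τ : ℝ, 0 < τ → ‖T τ‖ ≤ G τ) (g : ℝ → Y) (hg : Continuous g) (t : ℝ) :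
    ContinuousOn (fun s => T (t - s) (g s)) (Iio t) := by
  intro s₀ hs₀
  have hs : (0:ℝ) < t - s₀ := sub_pos.2 hs₀
  have hsub : Tendsto (fun s : ℝ => t - s) (nhds s₀) (nhds (t - s₀)) :=
    (continuous_const.sub continuous_id).tendsto s₀
  apply ContinuousAt.continuousWithinAt
  have A : Tendsto (fun s => T (t - s) (g s₀)) (nhds s₀) (nhds (T (t - s₀) (g s₀))) :=
    ((hTcont (g s₀)).continuousAt (Ioi_mem_nhds hs)).tendsto.comp hsub
  have Gt : Tendsto (fun s => G (t - s) * ‖g s - g s₀‖) (nhds s₀) (nhds 0) := by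
    have h1 : Tendsto (fun s => G (t - s)) (nhds s₀) (nhds (G (t - s₀))) :=
      (hG.continuousAt (Ioi_mem_nhds hs)).tendsto.comp hsub
    have h2 : Tendsto (fun s => ‖g s - g s₀‖) (nhds s₀) (nhds 0) := by
      have : Continuous (fun s => ‖g s - g s₀‖) := by fun_prop
      simpa using this.tendsto s₀
    simpa using h1.mul h2
  have Bz : Tendsto (fun s => T (t - s) (g s - g s₀)) (nhds s₀) (nhds 0) := by
    refine squeeze_zero_norm' ?_ Gt
    filter_upwards [Iio_mem_nhds hs₀] with s h
    exact (T (t - s)).le_of_opNorm_le (hT _ (sub_pos.2 h)) _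
  have := Bz.add A
  simpa [ContinuousAt] using this

theorem stmt10
    {X Y : Type*} [NormedAddCommGroup X] [NormedSpace ℝ X] [CompleteSpace X]
    [NormedAddCommGroup Y] [NormedSpace ℝ Y]
    (T : ℝ → Y →L[ℝ] X)
    (hTcont : ∀ y : Y, ContinuousOn (fun τ : ℝ => T τ y) (Ioi 0))
    (k lam a c : ℝ) (hk : 0 < k) (hlam : 0 < lam) (ha : a ∈ Ioo (0:ℝ) 1)
    (hT : ∀ τ : ℝ, 0 < τ → ‖T τ‖ ≤ k * (1 + τ ^ (-a)) * Real.exp (-lam * τ))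
    (B : X →L[ℝ] X →L[ℝ] Y)
    (hB : ∀ x x' : X, ‖B x x'‖ ≤ c * ‖x‖ * ‖x'‖)
    (f : BoundedContinuousFunction ℝ Y)
    (ρ : ℝ) (ω₁ ω₂ : BoundedContinuousFunction ℝ X)
    (hω₁ : ‖ω₁‖ ≤ ρ) (hω₂ : ‖ω₂‖ ≤ ρ) :
    ∀ t : ℝ, ‖(∫ s in Iio t, T (t - s) (B (ω₁ s) (ω₁ s) + f s)) -
        ∫ s in Iio t, T (t - s) (B (ω₂ s) (ω₂ s) + f s)‖ ≤
      2 * (k * (1 / lam + Real.Gamma (1 - a) * lam ^ (a - 1))) * c * ρ * ‖ω₁ - ω₂‖ := by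
  intro t
  rcases lt_or_ge c 0 with hc | hc
  · have hz : ∀ x : X, x = 0 := by
      intro x
      by_contra hx
      have h0 : 0 < ‖x‖ := norm_pos_iff.2 hx
      have h1 := (norm_nonneg _).trans (hB x x)
      nlinarith [mul_pos h0 h0]
    have : ω₁ = ω₂ := by
      ext s; rw [hz (ω₁ s), hz (ω₂ s)]
    subst this
    simp
  have hρ : 0 ≤ ρ := (norm_nonneg _).trans hω₁
  obtain ⟨hGi, hGe⟩ := aux_kernel k lam a hlam ha
  set G : ℝ → ℝ := fun τ => k * (1 + τ ^ (-a)) * Real.exp (-lam * τ) with hGdef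
  have hGc : ContinuousOn G (Ioi 0) := by
    have : ContinuousOn (fun τ : ℝ => τ ^ (-a)) (Ioi 0) := fun τ hτ =>
      (Real.continuousAt_rpow_const τ (-a) (Or.inl (ne_of_gt hτ))).continuousWithinAt
    have h2 : ContinuousOn (fun τ : ℝ => Real.exp (-lam * τ)) (Ioi 0) := by fun_prop
    exact (continuousOn_const.mul (continuousOn_const.add this)).mul h2
  obtain ⟨hRi, hRe⟩ := aux_reflect G t hGi
  have key : ∀ ω : BoundedContinuousFunction ℝ X, ‖ω‖ ≤ ρ →
      IntegrableOn (fun s => T (t - s) (B (ω s) (ω s) + f s)) (Iio t) := by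
    intro ω hω
    have hg : Continuous (fun s => B (ω s) (ω s) + f s) := by
      have := ω.continuous
      have := f.continuous
      fun_prop
    refine Integrable.mono' (hRi.mul_const (c * ρ * ρ + ‖f‖))
      ((aux_cont T hTcont G hGc hT _ hg t).aestronglyMeasurable measurableSet_Iio) ?_
    filter_upwards [ae_restrict_mem measurableSet_Iio] with s hs
    have hτ : 0 < t - s := sub_pos.2 hs
    refine (T (t - s)).le_of_opNorm_le_of_le (hT _ hτ) ?_
    have h1 : ‖ω s‖ ≤ ρ := (ω.norm_coe_le_norm s).trans hω
    have h2 := f.norm_coe_le_norm s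
    refine (norm_add_le _ _).trans (add_le_add ((hB _ _).trans ?_) h2)
    gcongr
  rw [← integral_sub (key ω₁ hω₁) (key ω₂ hω₂)]
  have hfin : ∫ s in Iio t, G (t - s) * (2 * c * ρ * ‖ω₁ - ω₂‖) =
      2 * (k * (1 / lam + Real.Gamma (1 - a) * lam ^ (a - 1))) * c * ρ * ‖ω₁ - ω₂‖ := by
    rw [integral_mul_const, hRe, hGe]; ring
  rw [← hfin]
  refine norm_integral_le_of_norm_le (hRi.mul_const _) ?_
  filter_upwards [ae_restrict_mem measurableSet_Iio] with s hs
  have hτ : 0 < t - s := sub_pos.2 hs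
  rw [← map_sub]
  refine (T (t - s)).le_of_opNorm_le_of_le (hT _ hτ) ?_
  have h1 : ‖ω₁ s‖ ≤ ρ := (ω₁.norm_coe_le_norm s).trans hω₁
  have h2 : ‖ω₂ s‖ ≤ ρ := (ω₂.norm_coe_le_norm s).trans hω₂
  have hd : ‖ω₁ s - ω₂ s‖ ≤ ‖ω₁ - ω₂‖ := (ω₁ - ω₂).norm_coe_le_norm s
  have e : B (ω₁ s) (ω₁ s) + f s - (B (ω₂ s) (ω₂ s) + f s) =
      B (ω₁ s - ω₂ s) (ω₁ s) + B (ω₂ s) (ω₁ s - ω₂ s) := by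
    simp only [map_sub, ContinuousLinearMap.sub_apply]; abel
  rw [e]
  calc _ ≤ c * ‖ω₁ s - ω₂ s‖ * ‖ω₁ s‖ + c * ‖ω₂ s‖ * ‖ω₁ s - ω₂ s‖ :=
        (norm_add_le _ _).trans (add_le_add (hB _ _) (hB _ _))
    _ ≤ c * ‖ω₁ - ω₂‖ * ρ + c * ρ * ‖ω₁ - ω₂‖ := by gcongr
    _ = _ := by ring
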